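/- arXiv:1605.01276 — 3 statements merged into one kernel-verified Lean document; each statement's English description precedes it below -/
import Mathlib

section
/- Let n ≥ 1 and let ρ : ℝⁿ → ℝ be three times continuously differentiable with ρ(x) > 0 for all x. Then for each index i and all x, Σⱼ ∂ⱼ( ρ ∂ᵢ∂ⱼ (log ρ) )(x) = 2 ρ(x) ∂ᵢ( Δ√ρ / √ρ )(x); that is, div(ρ ∇² log ρ) = 2 ρ ∇( Δ√ρ / √ρ ). -/
/-- The partial derivative `∂ᵢ f` of a scalar function on `ℝⁿ`. -/
noncomputable def pd {n : ℕ} (i : Fin n) (f : (Fin n → ℝ) → ℝ) (x : Fin n → ℝ) : ℝ :=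
  fderiv ℝ f x (Pi.single i 1)

section PartialDerivatives

variable {n : ℕ} {f g : (Fin n → ℝ) → ℝ} {x : Fin n → ℝ}

theorem ContDiff.contDiff_pd {m k : WithTop ℕ∞} (hf : ContDiff ℝ k f) (h : m + 1 ≤ k) (i : Fin n) :
    ContDiff ℝ m (pd i f) :=
  (hf.fderiv_right h).clm_apply contDiff_const

theorem pd_mul (hf : DifferentiableAt ℝ f x) (hg : DifferentiableAt ℝ g x) (i : Fin n) :
    pd i (fun y => f y * g y) x = f x * pd i g x + g x * pd i f x := by
  simp [pd, fderiv_fun_mul hf hg]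

theorem pd_add (hf : DifferentiableAt ℝ f x) (hg : DifferentiableAt ℝ g x) (i : Fin n) :
    pd i (fun y => f y + g y) x = pd i f x + pd i g x := by
  simp [pd, fderiv_fun_add hf hg]

theorem pd_const_mul (hf : DifferentiableAt ℝ f x) (c : ℝ) (i : Fin n) :
    pd i (fun y => c * f y) x = c * pd i f x := by
  simp [pd, fderiv_const_mul hf c]

theorem pd_sum {ι : Type*} {s : Finset ι} {F : ι → (Fin n → ℝ) → ℝ}
    (hF : ∀ j ∈ s, DifferentiableAt ℝ (F j) x) (i : Fin n) :
    pd i (fun y => ∑ j ∈ s, F j y) x = ∑ j ∈ s, pd i (F j) x := by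
  simp [pd, fderiv_fun_sum hF]

theorem pd_exp (hf : DifferentiableAt ℝ f x) (i : Fin n) :
    pd i (fun y => Real.exp (f y)) x = Real.exp (f x) * pd i f x := by
  simp [pd, fderiv_exp hf]

/-- Symmetry of second partial derivatives. -/
theorem pd_comm (hf : ContDiff ℝ 2 f) (i j : Fin n) (x : Fin n → ℝ) :
    pd i (pd j f) x = pd j (pd i f) x := by
  have hd : DifferentiableAt ℝ (fderiv ℝ f) x :=
    (hf.fderiv_right (m := 1) (by norm_num)).differentiable (by norm_num) x
  have key (a b : Fin n) : pd a (pd b f) x =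
      fderiv ℝ (fderiv ℝ f) x (Pi.single a 1) (Pi.single b 1) := by
    change fderiv ℝ (fun y => fderiv ℝ f y (Pi.single b 1)) x (Pi.single a 1) = _
    simp [fderiv_clm_apply hd (differentiableAt_const _)]
  rw [key, key]
  exact (hf.contDiffAt.isSymmSndFDerivAt (by simp)).eq _ _

/-- The summands of the divergence of `exp L ∇² L`, in terms of the derivatives of `L`. -/
theorem pd_exp_mul_pd_pd {L : (Fin n → ℝ) → ℝ} (hL : ContDiff ℝ 3 L) (i j : Fin n)
    (x : Fin n → ℝ) :
    pd j (fun y => Real.exp (L y) * pd i (pd j L) y) x =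
      Real.exp (L x) * (pd i (pd j (pd j L)) x + pd j L x * pd i (pd j L) x) := by
  have h1 : ContDiff ℝ 2 (pd j L) := hL.contDiff_pd (by norm_num) j
  have h2 : ContDiff ℝ 1 (pd i (pd j L)) := h1.contDiff_pd (by norm_num) i
  have hLd : DifferentiableAt ℝ L x := hL.differentiable (by norm_num) x
  rw [pd_mul hLd.exp (h2.differentiable (by norm_num) x), pd_exp hLd, pd_comm h1 j i]
  ring

/-- The second derivatives of `exp (L / 2)`. -/
theorem pd_pd_exp_half {L : (Fin n → ℝ) → ℝ} (hL : ContDiff ℝ 2 L) (j : Fin n)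
    (x : Fin n → ℝ) :
    pd j (pd j (fun z => Real.exp (1 / 2 * L z))) x =
      Real.exp (1 / 2 * L x) *
        (1 / 2 * pd j (pd j L) x + 1 / 4 * (pd j L x * pd j L x)) := by
  have hLd : Differentiable ℝ L := hL.differentiable (by norm_num)
  have h1 : Differentiable ℝ (pd j L) :=
    (hL.contDiff_pd (m := 1) (by norm_num) j).differentiable (by norm_num)
  have hhalf : Differentiable ℝ (fun z => 1 / 2 * L z) := hLd.const_mul _
  have hfst : pd j (fun z => Real.exp (1 / 2 * L z)) =
      fun y => Real.exp (1 / 2 * L y) * (1 / 2 * pd j L y) := by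
    funext y
    rw [pd_exp (hhalf y), pd_const_mul (hLd y)]
  rw [hfst, pd_mul (hhalf x).exp ((h1 x).const_mul _), pd_exp (hhalf x), pd_const_mul (hLd x),
    pd_const_mul (h1 x)]
  ring

end PartialDerivatives


/-- For `ρ : ℝⁿ → ℝ` three times continuously differentiable and positive,
`Σⱼ ∂ⱼ(ρ ∂ᵢ∂ⱼ log ρ) = 2 ρ ∂ᵢ(Δ√ρ / √ρ)`, i.e. `div(ρ ∇² log ρ) = 2 ρ ∇(Δ√ρ/√ρ)`. -/
theorem statement5 (n : ℕ) (hn : 1 ≤ n) (ρ : (Fin n → ℝ) → ℝ)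
    (hρ : ContDiff ℝ 3 ρ) (hpos : ∀ x, 0 < ρ x) (i : Fin n) (x : Fin n → ℝ) :
    ∑ j, pd j (fun y => ρ y * pd i (pd j (fun z => Real.log (ρ z))) y) x =
      2 * ρ x *
        pd i (fun y =>
          (∑ j, pd j (pd j (fun z => Real.sqrt (ρ z))) y) / Real.sqrt (ρ y)) x := by
  obtain ⟨L, hL, rfl⟩ : ∃ L : (Fin n → ℝ) → ℝ, ContDiff ℝ 3 L ∧ ρ = fun y => Real.exp (L y) :=
    ⟨fun y => Real.log (ρ y), hρ.log fun y => (hpos y).ne',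
      funext fun y => (Real.exp_log (hpos y)).symm⟩
  have hsqrt (y : Fin n → ℝ) : Real.sqrt (Real.exp (L y)) = Real.exp (1 / 2 * L y) := by
    rw [one_div_mul_eq_div, Real.exp_half]
  have hquot : (fun y => (∑ j, pd j (pd j (fun z => Real.exp (1 / 2 * L z))) y) /
      Real.exp (1 / 2 * L y)) =
      fun y => ∑ j, (1 / 2 * pd j (pd j L) y + 1 / 4 * (pd j L y * pd j L y)) := by
    funext y
    simp_rw [pd_pd_exp_half (hL.of_le (by norm_num)), ← Finset.mul_sum]
    exact mul_div_cancel_left₀ _ (Real.exp_ne_zero _)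
  have h1 (j : Fin n) : DifferentiableAt ℝ (pd j L) x :=
    (hL.contDiff_pd (m := 2) (by norm_num) j).differentiable (by norm_num) x
  have h2 (j : Fin n) : DifferentiableAt ℝ (pd j (pd j L)) x :=
    ((hL.contDiff_pd (m := 2) (by norm_num) j).contDiff_pd (m := 1) (by norm_num) j).differentiable (by norm_num) x
  have hmul (j : Fin n) : DifferentiableAt ℝ (fun y => pd j L y * pd j L y) x :=
    (h1 j).mul (h1 j)
  have hterm (j : Fin n) : DifferentiableAt ℝ
      (fun y => 1 / 2 * pd j (pd j L) y + 1 / 4 * (pd j L y * pd j L y)) x :=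
    ((h2 j).const_mul _).add ((hmul j).const_mul _)
  simp only [Real.log_exp, hsqrt]
  rw [hquot, pd_sum fun j _ => hterm j, Finset.mul_sum]
  refine Finset.sum_congr rfl fun j _ => ?_
  rw [pd_exp_mul_pd_pd hL, pd_add ((h2 j).const_mul _) ((hmul j).const_mul _),
    pd_const_mul (h2 j), pd_const_mul (hmul j), pd_mul (h1 j) (h1 j)]
  ring
end

section
/- Let n ≥ 1, T > 0, let v : [0,T] × ℝⁿ → ℝⁿ and π : [0,T] × ℝⁿ → ℝ be smooth and ℤⁿ-periodic in the space variable, and suppose div v = 0 and ∂ₜv + (v·∇)v + ∇π = 0 on [0,T] × ℝⁿ. Then the kinetic energy t ↦ (1/2) ∫_{[0,1]ⁿ} |v(t,x)|² dx is constant on [0,T]. -/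
/-- A function on `ℝⁿ` is `ℤⁿ`-periodic if `f (x + k) = f x` for every `k ∈ ℤⁿ`. -/
def ZPeriodic {n : ℕ} {E : Type*} (f : (Fin n → ℝ) → E) : Prop :=
  ∀ (x : Fin n → ℝ) (k : Fin n → ℤ), f (x + fun i => (k i : ℝ)) = f x

open MeasureTheory Set Topology

/-- Differentiation under the integral sign over a compact set, for a `C¹` integrand. -/
theorem hasDerivAt_setIntegral_of_contDiff {E : Type*} [NormedAddCommGroup E] [NormedSpace ℝ E]
    [MeasurableSpace E] [BorelSpace E] {μ : Measure E} [IsFiniteMeasureOnCompacts μ]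
    {K : Set E} (hK : IsCompact K) {f : ℝ → E → ℝ}
    (hf : ContDiff ℝ 1 (fun p : ℝ × E => f p.1 p.2)) (t : ℝ) :
    HasDerivAt (fun s => ∫ x in K, f s x ∂μ) (∫ x in K, deriv (fun s => f s x) t ∂μ) t := by
  have hder : ∀ s x, HasDerivAt (fun r => f r x)
      (fderiv ℝ (fun p : ℝ × E => f p.1 p.2) (s, x) (1, 0)) s := fun s x =>
    HasFDerivAt.comp_hasDerivAt (f := fun r => (r, x)) s
      (hf.differentiable one_ne_zero (s, x)).hasFDerivAt
      ((hasDerivAt_id s).prodMk (hasDerivAt_const s x))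
  have hcont : Continuous fun p : ℝ × E => deriv (fun r => f r p.2) p.1 := by
    simp only [(hder _ _).deriv]
    exact (hf.continuous_fderiv one_ne_zero).clm_apply continuous_const
  have hslice : ∀ s, ContinuousOn (f s) K := fun s =>
    (hf.continuous.comp (Continuous.prodMk_right s)).continuousOn
  obtain ⟨C, hC⟩ := ((isCompact_Icc (a := t - 1) (b := t + 1)).prod hK).exists_bound_of_continuousOn
    hcont.continuousOn
  refine (hasDerivAt_integral_of_dominated_loc_of_deriv_le (bound := fun _ => C)
    (F' := fun s x => deriv (fun r => f r x) s)
    (Icc_mem_nhds (sub_one_lt t) (lt_add_one t)) ?_ ?_ ?_ ?_ ?_ ?_).2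
  · exact .of_forall fun s => ((hslice s).integrableOn_compact hK).aestronglyMeasurable
  · exact (hslice t).integrableOn_compact hK
  · exact ((hcont.comp (Continuous.prodMk_right t)).continuousOn.integrableOn_compact
      hK).aestronglyMeasurable
  · exact (ae_restrict_mem hK.measurableSet).mono fun x hx s hs => hC (s, x) ⟨hs, hx⟩
  · exact continuousOn_const.integrableOn_compact hK
  · exact .of_forall fun x s _ => (hder s x).differentiableAt.hasDerivAt

/-- The divergence of a `C¹` periodic vector field integrates to zero over the unit cube. -/
theorem integral_divergence_eq_zero_of_zPeriodic {n : ℕ} {F : Fin n → (Fin n → ℝ) → ℝ}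
    (hF : ∀ i, ContDiff ℝ 1 (F i)) (hper : ∀ i, ZPeriodic (F i)) :
    ∫ x in Icc (0 : Fin n → ℝ) 1, ∑ i, pd i (F i) x = 0 := by
  cases n with
  | zero => simp
  | succ m =>
    have hcont : Continuous fun x => ∑ i, pd i (F i) x := continuous_finsetSum _ fun i _ =>
      ((hF i).continuous_fderiv one_ne_zero).clm_apply continuous_const
    refine (integral_divergence_of_hasFDerivAt_off_countable' (0 : Fin (m + 1) → ℝ) 1 zero_le_one
      F (fun i => fderiv ℝ (F i)) ∅ countable_empty (fun i => (hF i).continuous.continuousOn)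
      (fun x _ i => ((hF i).differentiable one_ne_zero x).hasFDerivAt)
      (hcont.continuousOn.integrableOn_compact isCompact_Icc)).trans ?_
    refine Finset.sum_eq_zero fun i _ => sub_eq_zero.2 (integral_congr_ae (.of_forall fun x => ?_))
    have hshift : i.insertNth (1 : ℝ) x
        = i.insertNth (0 : ℝ) x + fun j => ((Pi.single i 1 : Fin (m + 1) → ℤ) j : ℝ) := by
      ext j
      induction j using i.succAboveCases <;> simp
    change F i (i.insertNth (1 : ℝ) x) = F i (i.insertNth (0 : ℝ) x)
    rw [hshift, hper i]

/-- For a divergence-free field `u`, the divergence of `(|u|² + 2p) u` is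
`2 u · ((u · ∇) u + ∇p)`. -/
theorem sum_pd_energyFlux {n : ℕ} {u : (Fin n → ℝ) → Fin n → ℝ} {p : (Fin n → ℝ) → ℝ}
    {x : Fin n → ℝ} (hu : ∀ i, DifferentiableAt ℝ (fun y => u y i) x)
    (hp : DifferentiableAt ℝ p x) (hdiv : ∑ i, pd i (fun y => u y i) x = 0) :
    ∑ j, pd j (fun y => u y j * (∑ i, u y i ^ 2 + 2 * p y)) x
      = 2 * ∑ i, u x i * (∑ j, u x j * pd j (fun y => u y i) x + pd i p x) := by
  have hpd : ∀ j, pd j (fun y => u y j * (∑ i, u y i ^ 2 + 2 * p y)) x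
      = pd j (fun y => u y j) x * (∑ i, u x i ^ 2 + 2 * p x)
        + (∑ i, 2 * (u x i * (u x j * pd j (fun y => u y i) x))
          + 2 * (u x j * pd j p x)) := by
    intro j
    have h := (hu j).hasFDerivAt.mul ((HasFDerivAt.fun_sum (u := Finset.univ) fun i _ =>
      (hu i).hasFDerivAt.pow 2).add (hp.hasFDerivAt.const_mul 2))
    refine (congrArg (fun L => L (Pi.single j 1)) h.fderiv).trans ?_
    have hsum : ∑ i, u x j * (2 * u x i * pd j (fun y => u y i) x)
        = ∑ i, 2 * (u x i * (u x j * pd j (fun y => u y i) x)) :=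
      Finset.sum_congr rfl fun i _ => by ring
    rw [← hsum, ← Finset.mul_sum]
    simp [pd]
    ring
  simp only [hpd]
  rw [Finset.sum_add_distrib, ← Finset.sum_mul, hdiv, zero_mul, zero_add, Finset.sum_add_distrib,
    Finset.sum_comm]
  simp only [mul_add, Finset.sum_add_distrib, Finset.mul_sum]

/-- Conservation of the kinetic energy `(1/2)∫|v|² dx` for smooth
spatially `ℤⁿ`-periodic solutions of the incompressible Euler equations
`div v = 0`, `∂ₜv + (v·∇)v + ∇π = 0` on `[0,T] × ℝⁿ`. -/
theorem statement10 (n : ℕ) (hn : 1 ≤ n) (T : ℝ) (hT : 0 < T)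
    (v : ℝ → (Fin n → ℝ) → Fin n → ℝ) (π : ℝ → (Fin n → ℝ) → ℝ)
    (hv : ContDiff ℝ (⊤ : ℕ∞) (fun p : ℝ × (Fin n → ℝ) => v p.1 p.2))
    (hπ : ContDiff ℝ (⊤ : ℕ∞) (fun p : ℝ × (Fin n → ℝ) => π p.1 p.2))
    (hvper : ∀ t, ZPeriodic (v t)) (hπper : ∀ t, ZPeriodic (π t))
    (hdiv : ∀ t ∈ Set.Icc (0 : ℝ) T, ∀ x, ∑ i, pd i (fun y => v t y i) x = 0)
    (heq : ∀ t ∈ Set.Icc (0 : ℝ) T, ∀ x, ∀ i,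
      deriv (fun s => v s x i) t
        + (∑ j, v t x j * pd j (fun y => v t y i) x) + pd i (π t) x = 0) :
    ∀ t ∈ Set.Icc (0 : ℝ) T,
      (1 / 2) * ∫ x in Set.Icc (0 : Fin n → ℝ) 1, ∑ i, v t x i ^ 2
        = (1 / 2) * ∫ x in Set.Icc (0 : Fin n → ℝ) 1, ∑ i, v 0 x i ^ 2 := by
  have hvi : ∀ i, ContDiff ℝ 1 (fun p : ℝ × (Fin n → ℝ) => v p.1 p.2 i) := fun i =>
    (contDiff_pi.1 hv i).of_le (mod_cast le_top)
  have hvx : ∀ t i, ContDiff ℝ 1 (fun x => v t x i) := fun t i =>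
    (hvi i).comp (contDiff_prodMk_right t)
  have hvt : ∀ t x i, DifferentiableAt ℝ (fun s => v s x i) t := fun t x i =>
    ((hvi i).comp (contDiff_prodMk_left x)).differentiable one_ne_zero t
  have hπx : ∀ t, ContDiff ℝ 1 (π t) := fun t =>
    (hπ.of_le (mod_cast le_top)).comp (contDiff_prodMk_right t)
  have henergy := hasDerivAt_setIntegral_of_contDiff (μ := volume)
    (isCompact_Icc (a := (0 : Fin n → ℝ)) (b := 1)) (f := fun t x => ∑ i, v t x i ^ 2)
    (ContDiff.sum fun i _ => (hvi i).pow 2)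
  have hzero : ∀ t ∈ Icc (0 : ℝ) T,
      ∫ x in Icc (0 : Fin n → ℝ) 1, deriv (fun s => ∑ i, v s x i ^ 2) t = 0 := by
    intro t ht
    have hflux := integral_divergence_eq_zero_of_zPeriodic
      (F := fun j y => v t y j * (∑ i, v t y i ^ 2 + 2 * π t y))
      (fun j => (hvx t j).mul ((ContDiff.sum fun i _ => (hvx t i).pow 2).add
        (contDiff_const.mul (hπx t))))
      (fun j x k => by simp only [hvper t x k, hπper t x k])
    rw [← neg_eq_zero, ← hflux, ← integral_neg]
    refine integral_congr_ae (.of_forall fun x => ?_)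
    have hder : deriv (fun s => ∑ i, v s x i ^ 2) t
        = ∑ i, 2 * v t x i * deriv (fun s => v s x i) t := by
      refine (HasDerivAt.fun_sum fun i _ => ?_).deriv
      simpa using (hvt t x i).hasDerivAt.fun_pow 2
    simp only [hder]
    rw [sum_pd_energyFlux (fun i => (hvx t i).differentiable one_ne_zero x)
      ((hπx t).differentiable one_ne_zero x) (hdiv t ht x), Finset.mul_sum, ← Finset.sum_neg_distrib]
    refine Finset.sum_congr rfl fun i _ => ?_
    linear_combination (-2 * v t x i) * heq t ht x i
  intro t ht
  congr 1
  exact constant_of_has_deriv_right_zero (fun s _ => (henergy s).continuousAt.continuousWithinAt)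
    (fun s hs => hzero s (Ico_subset_Icc_self hs) ▸ (henergy s).hasDerivWithinAt) t ht
end

section
/- Let n ≥ 1, γ > 1, T > 0. Let ρ : [0,T] × ℝⁿ → ℝ and J : [0,T] × ℝⁿ → ℝⁿ be smooth, ℤⁿ-periodic in the space variable, with ρ > 0 everywhere, satisfying the quantum hydrodynamic system ∂ₜρ + div J = 0 and ∂ₜJ + div(J⊗J/ρ) + ∇(ρ^γ/γ) = div(ρ ∇² log ρ) on [0,T] × ℝⁿ. Then the energy E(t) = ∫_{[0,1]ⁿ} [ (|J(t,x)|² + |∇ρ(t,x)|²)/(2 ρ(t,x)) + (ρ(t,x)^γ − 1 − γ(ρ(t,x) − 1))/(γ(γ−1)) ] dx is constant on [0,T]. -/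
open MeasureTheory Set Filter Topology

section DirectionalDerivative

variable {E : Type*} [NormedAddCommGroup E] [NormedSpace ℝ E]

/-- The derivative of a scalar function in the direction `v`. -/
noncomputable def dirDeriv (v : E) (f : E → ℝ) (p : E) : ℝ := fderiv ℝ f p v

@[fun_prop]
theorem contDiff_dirDeriv {f : E → ℝ} (hf : ContDiff ℝ (⊤ : ℕ∞) f) (v : E) :
    ContDiff ℝ (⊤ : ℕ∞) (dirDeriv v f) :=
  (hf.fderiv_right (m := (⊤ : ℕ∞)) (by simp)).clm_apply contDiff_const

theorem ContDiff.differentiableAt_of_top {f : E → ℝ} (hf : ContDiff ℝ (⊤ : ℕ∞) f) (p : E) :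
    DifferentiableAt ℝ f p :=
  (hf.differentiable (by simp)) p

theorem dirDeriv_comm {f : E → ℝ} (hf : ContDiff ℝ (⊤ : ℕ∞) f) (v w : E) :
    dirDeriv v (dirDeriv w f) = dirDeriv w (dirDeriv v f) := by
  have key : ∀ a b p, dirDeriv a (dirDeriv b f) p = fderiv ℝ (fderiv ℝ f) p a b := by
    intro a b p
    have hd : DifferentiableAt ℝ (fderiv ℝ f) p :=
      ((hf.fderiv_right (m := (⊤ : ℕ∞)) (by simp)).differentiable (by simp)) p
    change fderiv ℝ (fun q => fderiv ℝ f q b) p a = _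
    rw [fderiv_clm_apply hd (differentiableAt_const b)]
    simp
  funext p
  rw [key, key]
  exact (hf.contDiffAt.isSymmSndFDerivAt
    (by simpa using WithTop.coe_le_coe.2 (le_top : (2 : ℕ∞) ≤ ⊤))) v w

theorem dirDeriv_fun_mul {f g : E → ℝ} (hf : ContDiff ℝ (⊤ : ℕ∞) f)
    (hg : ContDiff ℝ (⊤ : ℕ∞) g) (v p : E) :
    dirDeriv v (fun q => f q * g q) p = dirDeriv v f p * g p + f p * dirDeriv v g p := by
  simp only [dirDeriv]
  rw [fderiv_fun_mul (hf.differentiableAt_of_top p) (hg.differentiableAt_of_top p)]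
  simp only [FunLike.coe_add, FunLike.coe_smul, Pi.add_apply, Pi.smul_apply, smul_eq_mul]
  ring

theorem dirDeriv_fun_add {f g : E → ℝ} (hf : ContDiff ℝ (⊤ : ℕ∞) f)
    (hg : ContDiff ℝ (⊤ : ℕ∞) g) (v p : E) :
    dirDeriv v (fun q => f q + g q) p = dirDeriv v f p + dirDeriv v g p := by
  simp only [dirDeriv]
  rw [fderiv_fun_add (hf.differentiableAt_of_top p) (hg.differentiableAt_of_top p)]
  rfl

theorem dirDeriv_fun_sub {f g : E → ℝ} (hf : ContDiff ℝ (⊤ : ℕ∞) f)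
    (hg : ContDiff ℝ (⊤ : ℕ∞) g) (v p : E) :
    dirDeriv v (fun q => f q - g q) p = dirDeriv v f p - dirDeriv v g p := by
  simp only [dirDeriv]
  rw [fderiv_fun_sub (hf.differentiableAt_of_top p) (hg.differentiableAt_of_top p)]
  rfl

theorem dirDeriv_fun_sum {ι : Type*} [Fintype ι] {f : ι → E → ℝ}
    (hf : ∀ i, ContDiff ℝ (⊤ : ℕ∞) (f i)) (v p : E) :
    dirDeriv v (fun q => ∑ i, f i q) p = ∑ i, dirDeriv v (f i) p := by
  simp only [dirDeriv]
  rw [fderiv_fun_sum fun i _ => (hf i).differentiableAt_of_top p]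
  simp

theorem dirDeriv_half_sum_sq {ι : Type*} [Fintype ι] {f : ι → E → ℝ}
    (hf : ∀ i, ContDiff ℝ (⊤ : ℕ∞) (f i)) (v p : E) :
    dirDeriv v (fun q => ∑ i, f i q * f i q / 2) p = ∑ i, f i p * dirDeriv v (f i) p := by
  rw [dirDeriv_fun_sum fun i => by fun_prop]
  refine Finset.sum_congr rfl fun i _ => ?_
  have h := dirDeriv_fun_mul (f := fun _ : E => (1 / 2 : ℝ)) (g := fun q => f i q * f i q)
    contDiff_const ((hf i).mul (hf i)) v p
  have h0 : dirDeriv v (fun _ : E => (1 / 2 : ℝ)) p = 0 := by simp [dirDeriv]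
  rw [dirDeriv_fun_mul (hf i) (hf i), h0] at h
  have h1 : (fun q => f i q * f i q / 2) = fun q => (1 / 2 : ℝ) * (f i q * f i q) := by
    funext q; ring
  rw [h1, h]
  ring

theorem dirDeriv_comp_of_hasDerivAt {f : E → ℝ} (hf : ContDiff ℝ (⊤ : ℕ∞) f) {φ : ℝ → ℝ}
    {φ' : ℝ} (v p : E) (hφ : HasDerivAt φ φ' (f p)) :
    dirDeriv v (fun q => φ (f q)) p = φ' * dirDeriv v f p := by
  have h := hφ.comp_hasFDerivAt p (hf.differentiableAt_of_top p).hasFDerivAt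
  exact (congrArg (fun A : E →L[ℝ] ℝ => A v) h.fderiv).trans (by simp [dirDeriv])

theorem dirDeriv_add_period {f : E → ℝ} {k : E} (hf : ∀ p, f (p + k) = f p) (v p : E) :
    dirDeriv v f (p + k) = dirDeriv v f p := by
  simp only [dirDeriv]
  rw [← fderiv_comp_add_right, funext hf]

end DirectionalDerivative

/-- The finite-sum identity behind the local energy balance. -/
theorem energy_balance_sum {ι : Type*} [Fintype ι] (r l rt P Q : ℝ)
    (u ut a lt pi lap m : ι → ℝ) (du da : ι → ι → ℝ) (K S Δ : ℝ)
    (hrt : rt = r * l)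
    (hQ : Q = Δ + S - K - P) (hS : ∑ i, a i * a i / 2 = S)
    (dL : ι → ℝ) (hΔ : ∑ i, dL i = Δ)
    (hmass : rt + ∑ i, m i = 0)
    (hmom : ∀ i, rt * u i + r * ut i + (∑ j, (m j * u i + r * u j * du j i)) + r * pi i
      = ∑ j, (r * a j * da i j) + r * lap i) :
    rt * K + r * ∑ i, u i * ut i + (rt * S + r * ∑ i, a i * lt i) + P * rt
      = ∑ i, (m i * Q + r * u i * (lap i + ∑ j, a j * da i j - ∑ j, u j * du i j - pi i)
          + (dL i * rt + a i * (r * a i * l + r * lt i))) := by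
  have h1 : ∀ i, r * (u i * ut i) = r * u i * (lap i + ∑ j, a j * da i j - pi i)
      - ∑ j, r * u i * (u j * du j i) := by
    intro i
    have h := hmom i
    rw [Finset.sum_add_distrib, ← Finset.sum_mul] at h
    have e1 : ∑ j, r * a j * da i j = r * ∑ j, a j * da i j := by
      rw [Finset.mul_sum]; exact Finset.sum_congr rfl fun _ _ => by ring
    have e2 : ∑ j, r * u j * du j i = r * ∑ j, u j * du j i := by
      rw [Finset.mul_sum]; exact Finset.sum_congr rfl fun _ _ => by ring
    have e3 : ∑ j, r * u i * (u j * du j i) = r * u i * ∑ j, u j * du j i := by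
      rw [Finset.mul_sum]
    rw [e1, e2] at h
    rw [e3]
    linear_combination u i * h - u i * u i * hmass
  have h2 : ∑ i, ∑ j, r * u i * (u j * du j i) = ∑ i, r * u i * ∑ j, u j * du i j := by
    rw [Finset.sum_comm]
    refine Finset.sum_congr rfl fun i _ => ?_
    rw [Finset.mul_sum]
    exact Finset.sum_congr rfl fun _ _ => by ring
  have h3 : r * ∑ i, u i * ut i
      = ∑ i, r * u i * (lap i + ∑ j, a j * da i j - ∑ j, u j * du i j - pi i) := by
    rw [Finset.mul_sum, Finset.sum_congr rfl fun i _ => h1 i, Finset.sum_sub_distrib, h2,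
      ← Finset.sum_sub_distrib]
    exact Finset.sum_congr rfl fun _ _ => by ring
  have h4 : ∑ i, a i * (r * a i * l + r * lt i) = 2 * rt * S + r * ∑ i, a i * lt i := by
    rw [← hS, Finset.mul_sum, Finset.mul_sum, ← Finset.sum_add_distrib]
    exact Finset.sum_congr rfl fun _ _ => by rw [hrt]; ring
  rw [Finset.sum_add_distrib, Finset.sum_add_distrib, Finset.sum_add_distrib, ← Finset.sum_mul,
    ← Finset.sum_mul, ← h3, h4, hΔ, hQ]
  linear_combination (-(Δ + S - K - P)) * hmass

/-- Local energy balance: at a point where the mass and momentum equations hold, the time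
derivative of the energy density is a spatial divergence. Here `R` is the density, `L` its
logarithm, `u` the velocity, `W` the internal energy density, `P` its derivative and `p` the
pressure. -/
theorem dirDeriv_energy_eq_divergence {E ι : Type*} [NormedAddCommGroup E] [NormedSpace ℝ E]
    [Fintype ι] {R L P W p : E → ℝ} {u : ι → E → ℝ} (τ : E) (e : ι → E)
    (hR : ContDiff ℝ (⊤ : ℕ∞) R) (hL : ContDiff ℝ (⊤ : ℕ∞) L) (hP : ContDiff ℝ (⊤ : ℕ∞) P)
    (hW : ContDiff ℝ (⊤ : ℕ∞) W) (hu : ∀ i, ContDiff ℝ (⊤ : ℕ∞) (u i))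
    (hRL : ∀ v, dirDeriv v R = fun q => R q * dirDeriv v L q)
    (hWP : ∀ v q, dirDeriv v W q = P q * dirDeriv v R q)
    (hpP : ∀ v q, dirDeriv v p q = R q * dirDeriv v P q) (x : E)
    (hmass : dirDeriv τ R x + ∑ i, dirDeriv (e i) (fun q => R q * u i q) x = 0)
    (hmom : ∀ i, dirDeriv τ (fun q => R q * u i q) x
        + (∑ j, dirDeriv (e j) (fun q => (R q * u j q) * u i q) x) + dirDeriv (e i) p x
      = ∑ j, dirDeriv (e j) (fun q => R q * dirDeriv (e i) (dirDeriv (e j) L) q) x) :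
    dirDeriv τ (fun q => R q * (∑ i, u i q * u i q / 2)
        + R q * (∑ i, dirDeriv (e i) L q * dirDeriv (e i) L q / 2) + W q) x
      = ∑ i, dirDeriv (e i) (fun q => R q * u i q * ((∑ j, dirDeriv (e j) (dirDeriv (e j) L) q)
          + (∑ j, dirDeriv (e j) L q * dirDeriv (e j) L q / 2)
          - (∑ j, u j q * u j q / 2) - P q) + dirDeriv (e i) L q * dirDeriv τ R q) x := by
  have hdL : ∀ v, ContDiff ℝ (⊤ : ℕ∞) (dirDeriv v L) := contDiff_dirDeriv hL
  have hddL : ∀ v w, ContDiff ℝ (⊤ : ℕ∞) (dirDeriv v (dirDeriv w L)) :=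
    fun v w => contDiff_dirDeriv (hdL w) v
  have hK : ContDiff ℝ (⊤ : ℕ∞) (fun q => ∑ i, u i q * u i q / 2) := by fun_prop
  have hS : ContDiff ℝ (⊤ : ℕ∞)
      (fun q => ∑ i, dirDeriv (e i) L q * dirDeriv (e i) L q / 2) := by fun_prop
  have hΔ : ContDiff ℝ (⊤ : ℕ∞) (fun q => ∑ j, dirDeriv (e j) (dirDeriv (e j) L) q) := by fun_prop
  have hRt : ContDiff ℝ (⊤ : ℕ∞) (dirDeriv τ R) := contDiff_dirDeriv hR τ
  have hRu : ∀ i, ContDiff ℝ (⊤ : ℕ∞) (fun q => R q * u i q) := fun i => hR.mul (hu i)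
  rw [dirDeriv_fun_add ((hR.mul hK).add (hR.mul hS)) hW, dirDeriv_fun_add (hR.mul hK) (hR.mul hS),
    dirDeriv_fun_mul hR hK, dirDeriv_fun_mul hR hS, hWP, dirDeriv_half_sum_sq hu,
    dirDeriv_half_sum_sq fun i => hdL (e i)]
  have hG : ∀ i, dirDeriv (e i) (fun q => R q * u i q *
          ((∑ j, dirDeriv (e j) (dirDeriv (e j) L) q)
          + (∑ j, dirDeriv (e j) L q * dirDeriv (e j) L q / 2)
          - (∑ j, u j q * u j q / 2) - P q) + dirDeriv (e i) L q * dirDeriv τ R q) x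
      = dirDeriv (e i) (fun q => R q * u i q) x * ((∑ j, dirDeriv (e j) (dirDeriv (e j) L) x)
          + (∑ j, dirDeriv (e j) L x * dirDeriv (e j) L x / 2)
          - (∑ j, u j x * u j x / 2) - P x)
        + R x * u i x * ((∑ j, dirDeriv (e i) (dirDeriv (e j) (dirDeriv (e j) L)) x)
          + (∑ j, dirDeriv (e j) L x * dirDeriv (e i) (dirDeriv (e j) L) x)
          - (∑ j, u j x * dirDeriv (e i) (u j) x) - dirDeriv (e i) P x)
        + (dirDeriv (e i) (dirDeriv (e i) L) x * dirDeriv τ R x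
          + dirDeriv (e i) L x * (R x * dirDeriv (e i) L x * dirDeriv τ L x
            + R x * dirDeriv τ (dirDeriv (e i) L) x)) := by
    intro i
    rw [dirDeriv_fun_add ((hRu i).mul (((hΔ.add hS).sub hK).sub hP)) ((hdL _).mul hRt),
      dirDeriv_fun_mul (hRu i) (((hΔ.add hS).sub hK).sub hP), dirDeriv_fun_mul (hdL _) hRt,
      dirDeriv_fun_sub ((hΔ.add hS).sub hK) hP, dirDeriv_fun_sub (hΔ.add hS) hK,
      dirDeriv_fun_add hΔ hS, dirDeriv_half_sum_sq hu, dirDeriv_half_sum_sq fun i => hdL (e i),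
      dirDeriv_fun_sum fun j => hddL (e j) (e j)]
    congr 3
    rw [hRL τ, dirDeriv_fun_mul hR (hdL τ), hRL (e i), dirDeriv_comm hL]
  rw [Finset.sum_congr rfl fun i _ => hG i]
  refine energy_balance_sum (R x) (dirDeriv τ L x) _ _ _ (fun i => u i x) _ _ _ _ _ _
    (fun i j => dirDeriv (e i) (u j) x) (fun i j => dirDeriv (e i) (dirDeriv (e j) L) x)
    _ _ _ (by rw [hRL]) rfl rfl _ rfl hmass fun i => ?_
  have h := hmom i
  rw [dirDeriv_fun_mul hR (hu i), hpP] at h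
  simp only [fun j => dirDeriv_fun_mul (hRu j) (hu i),
    fun j => dirDeriv_fun_mul hR (hddL (e i) (e j))] at h
  rw [h, Finset.mul_sum, ← Finset.sum_add_distrib]
  refine Finset.sum_congr rfl fun j _ => ?_
  rw [hRL (e j), dirDeriv_comm (hdL (e j))]

theorem pd_slice {n : ℕ} {F : ℝ × (Fin n → ℝ) → ℝ} (hF : ContDiff ℝ (⊤ : ℕ∞) F) (i : Fin n)
    (t : ℝ) (x : Fin n → ℝ) :
    pd i (fun y => F (t, y)) x = dirDeriv (0, Pi.single i 1) F (t, x) := by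
  have h := (hF.differentiableAt_of_top (t, x)).hasFDerivAt.comp x
    (hasFDerivAt_prodMk_right t x)
  exact (congrArg (fun A : (Fin n → ℝ) →L[ℝ] ℝ => A (Pi.single i 1)) h.fderiv).trans
    (by simp [dirDeriv])

theorem hasDerivAt_slice {V : Type*} [NormedAddCommGroup V] [NormedSpace ℝ V] {F : ℝ × V → ℝ}
    (hF : ContDiff ℝ (⊤ : ℕ∞) F) (t : ℝ) (x : V) :
    HasDerivAt (fun s => F (s, x)) (dirDeriv (1, 0) F (t, x)) t := by
  have h : HasDerivAt (fun s => F (s, x)) _ t :=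
    ((hF.differentiableAt_of_top (t, x)).hasFDerivAt.comp t
      (hasFDerivAt_prodMk_left (𝕜 := ℝ) t x)).hasDerivAt
  simpa [dirDeriv] using h

/-- The divergence of a smooth periodic vector field has vanishing integral over the unit cube. -/
theorem integral_sum_pd_eq_zero {n : ℕ} {g : Fin n → (Fin n → ℝ) → ℝ}
    (hg : ∀ i, ContDiff ℝ (⊤ : ℕ∞) (g i)) (hper : ∀ i, ZPeriodic (g i)) :
    ∫ x in Icc (0 : Fin n → ℝ) 1, ∑ i, pd i (g i) x = 0 := by
  cases n with
  | zero => simp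
  | succ n =>
    have hc : Continuous fun x => ∑ i, fderiv ℝ (g i) x (Pi.single i 1) :=
      continuous_finsetSum _ fun i _ => (contDiff_dirDeriv (hg i) _).continuous
    have key := integral_divergence_of_hasFDerivAt_off_countable' (0 : Fin (n + 1) → ℝ) 1
      zero_le_one g (fun i x => fderiv ℝ (g i) x) ∅ countable_empty
      (fun i => (hg i).continuous.continuousOn)
      (fun x _ i => ((hg i).differentiableAt_of_top x).hasFDerivAt)
      (hc.continuousOn.integrableOn_compact isCompact_Icc)
    simp only [pd]
    rw [key]
    refine Finset.sum_eq_zero fun i _ => ?_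
    rw [sub_eq_zero]
    congr 1
    funext y
    rw [← hper i (i.insertNth ((0 : Fin (n + 1) → ℝ) i) y) (Pi.single i 1)]
    congr 1
    funext j
    refine i.succAboveCases ?_ (fun k => ?_) j <;> simp

/-- Differentiation under the integral sign for a smooth function over a compact set. -/
theorem hasDerivAt_integral_of_contDiff_compact {V : Type*} [NormedAddCommGroup V]
    [NormedSpace ℝ V] [MeasurableSpace V] [BorelSpace V] [SecondCountableTopology V]
    {μ : Measure V} [IsLocallyFiniteMeasure μ] {F : ℝ × V → ℝ} (hF : ContDiff ℝ (⊤ : ℕ∞) F)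
    {K : Set V} (hK : IsCompact K) (t : ℝ) :
    HasDerivAt (fun s => ∫ x in K, F (s, x) ∂μ)
      (∫ x in K, dirDeriv (1, 0) F (t, x) ∂μ) t := by
  have hF' : Continuous (dirDeriv (1, 0) F) := (contDiff_dirDeriv hF _).continuous
  have hFc : Continuous F := hF.continuous
  obtain ⟨M, hM⟩ := (((isCompact_Icc (a := t - 1) (b := t + 1)).prod hK).bddAbove_image
    hF'.norm.continuousOn)
  refine (hasDerivAt_integral_of_dominated_loc_of_deriv_le
    (F' := fun s x => dirDeriv (1, 0) F (s, x)) (bound := fun _ => M)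
    (Icc_mem_nhds (sub_one_lt t) (lt_add_one t)) ?_ ?_ ?_ ?_ ?_ ?_).2
  · exact Eventually.of_forall fun s => (by fun_prop : Continuous _).aestronglyMeasurable
  · exact ((by fun_prop : Continuous fun x => F (t, x)).continuousOn).integrableOn_compact hK
  · exact (by fun_prop : Continuous fun x => dirDeriv (1, 0) F (t, x)).aestronglyMeasurable
  · filter_upwards [ae_restrict_mem hK.measurableSet] with x hx s hs
    exact hM (mem_image_of_mem _ (mk_mem_prod hs hx))
  · exact integrableOn_const hK.measure_ne_top
  · exact Eventually.of_forall fun x s _ => hasDerivAt_slice hF s x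

/-- For smooth spatially `ℤⁿ`-periodic positive solutions `(ρ, J)` of
the quantum hydrodynamic system `∂ₜρ + div J = 0`,
`∂ₜJ + div(J⊗J/ρ) + ∇(ρ^γ/γ) = div(ρ ∇² log ρ)` on `[0,T] × ℝⁿ` (with `γ > 1`), the energy
`E(t) = ∫ [ (|J|² + |∇ρ|²)/(2ρ) + (ρ^γ - 1 - γ(ρ-1))/(γ(γ-1)) ] dx` over the unit cube
is constant on `[0,T]`. -/
theorem statement11 (n : ℕ) (hn : 1 ≤ n) (γ : ℝ) (hγ : 1 < γ) (T : ℝ) (hT : 0 < T)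
    (ρ : ℝ → (Fin n → ℝ) → ℝ) (J : ℝ → (Fin n → ℝ) → Fin n → ℝ)
    (hρ : ContDiff ℝ (⊤ : ℕ∞) (fun p : ℝ × (Fin n → ℝ) => ρ p.1 p.2))
    (hJ : ContDiff ℝ (⊤ : ℕ∞) (fun p : ℝ × (Fin n → ℝ) => J p.1 p.2))
    (hρper : ∀ t, ZPeriodic (ρ t)) (hJper : ∀ t, ZPeriodic (J t))
    (hpos : ∀ t x, 0 < ρ t x)
    (hmass : ∀ t ∈ Set.Icc (0 : ℝ) T, ∀ x,
      deriv (fun s => ρ s x) t + ∑ i, pd i (fun y => J t y i) x = 0)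
    (hmom : ∀ t ∈ Set.Icc (0 : ℝ) T, ∀ x, ∀ i,
      deriv (fun s => J s x i) t
          + (∑ j, pd j (fun y => J t y i * J t y j / ρ t y) x)
          + pd i (fun y => ρ t y ^ γ / γ) x
        = ∑ j, pd j (fun y => ρ t y * pd i (pd j (fun z => Real.log (ρ t z))) y) x) :
    ∀ t ∈ Set.Icc (0 : ℝ) T,
      ∫ x in Set.Icc (0 : Fin n → ℝ) 1,
          (((∑ i, J t x i ^ 2) + ∑ i, pd i (ρ t) x ^ 2) / (2 * ρ t x)
            + (ρ t x ^ γ - 1 - γ * (ρ t x - 1)) / (γ * (γ - 1)))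
        = ∫ x in Set.Icc (0 : Fin n → ℝ) 1,
            (((∑ i, J 0 x i ^ 2) + ∑ i, pd i (ρ 0) x ^ 2) / (2 * ρ 0 x)
              + (ρ 0 x ^ γ - 1 - γ * (ρ 0 x - 1)) / (γ * (γ - 1))) := by
  set R : ℝ × (Fin n → ℝ) → ℝ := fun q => ρ q.1 q.2 with hRdef
  have hR0 : ∀ q, R q ≠ 0 := fun q => (hpos q.1 q.2).ne'
  have hJi : ∀ i, ContDiff ℝ (⊤ : ℕ∞) (fun q : ℝ × (Fin n → ℝ) => J q.1 q.2 i) :=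
    contDiff_pi.1 hJ
  let L : ℝ × (Fin n → ℝ) → ℝ := fun q => Real.log (R q)
  let u : Fin n → ℝ × (Fin n → ℝ) → ℝ := fun i q => J q.1 q.2 i / R q
  let P : ℝ × (Fin n → ℝ) → ℝ := fun q => (R q ^ (γ - 1) - 1) / (γ - 1)
  let W : ℝ × (Fin n → ℝ) → ℝ := fun q => (R q ^ γ - 1 - γ * (R q - 1)) / (γ * (γ - 1))
  let p : ℝ × (Fin n → ℝ) → ℝ := fun q => R q ^ γ / γ
  have hγ0 : γ ≠ 0 := by positivity
  have hγ1 : γ - 1 ≠ 0 := sub_ne_zero.2 hγ.ne'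
  have hL : ContDiff ℝ (⊤ : ℕ∞) L := hρ.log hR0
  have hu : ∀ i, ContDiff ℝ (⊤ : ℕ∞) (u i) := fun i => (hJi i).div hρ hR0
  have hpow : ∀ a : ℝ, ContDiff ℝ (⊤ : ℕ∞) (fun q => R q ^ a) := fun a =>
    hρ.rpow_const_of_ne hR0
  have hP : ContDiff ℝ (⊤ : ℕ∞) P := ((hpow _).sub contDiff_const).div_const _
  have hW : ContDiff ℝ (⊤ : ℕ∞) W :=
    (((hpow _).sub contDiff_const).sub (contDiff_const.mul (hρ.sub contDiff_const))).div_const _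
  have hp : ContDiff ℝ (⊤ : ℕ∞) p := (hpow _).div_const _
  have hRu : ∀ i, (fun q => R q * u i q) = fun q => J q.1 q.2 i := fun i =>
    funext fun q => mul_div_cancel₀ _ (hR0 q)
  have hRL : ∀ v, dirDeriv v R = fun q => R q * dirDeriv v L q := fun v => funext fun q => by
    have h := dirDeriv_comp_of_hasDerivAt hρ v q (Real.hasDerivAt_log (hR0 q))
    change dirDeriv v L q = (R q)⁻¹ * dirDeriv v R q at h
    rw [h, mul_inv_cancel_left₀ (hR0 q)]
  have hWP : ∀ v q, dirDeriv v W q = P q * dirDeriv v R q := fun v q => by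
    refine dirDeriv_comp_of_hasDerivAt hρ v q
      (φ := fun r => (r ^ γ - 1 - γ * (r - 1)) / (γ * (γ - 1))) ?_
    have h := ((((Real.hasDerivAt_rpow_const (p := γ) (Or.inl (hR0 q))).sub_const 1).sub
      (((hasDerivAt_id (R q)).sub_const 1).const_mul γ)).div_const (γ * (γ - 1)))
    refine HasDerivAt.congr_deriv h ?_
    simp only [P]
    field_simp
  have hpP : ∀ v q, dirDeriv v p q = R q * dirDeriv v P q := fun v q => by
    have h1 : dirDeriv v p q = R q ^ (γ - 1) * dirDeriv v R q := by
      refine dirDeriv_comp_of_hasDerivAt hρ v q (φ := fun r => r ^ γ / γ) ?_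
      refine ((Real.hasDerivAt_rpow_const (p := γ) (Or.inl (hR0 q))).div_const γ).congr_deriv ?_
      field_simp
    have h2 : dirDeriv v P q = R q ^ (γ - 1 - 1) * dirDeriv v R q := by
      refine dirDeriv_comp_of_hasDerivAt hρ v q (φ := fun r => (r ^ (γ - 1) - 1) / (γ - 1)) ?_
      refine (((Real.hasDerivAt_rpow_const (p := γ - 1) (Or.inl (hR0 q))).sub_const 1).div_const
        (γ - 1)).congr_deriv ?_
      field_simp
    rw [h1, h2, Real.rpow_sub_one (hR0 q) (γ - 1)]
    field_simp [hR0 q]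
  let b : Fin n → ℝ × (Fin n → ℝ) := fun i => (0, Pi.single i 1)
  let e : ℝ × (Fin n → ℝ) → ℝ := fun q => R q * (∑ i, u i q * u i q / 2)
    + R q * (∑ i, dirDeriv (b i) L q * dirDeriv (b i) L q / 2) + W q
  let G : Fin n → ℝ × (Fin n → ℝ) → ℝ := fun i q =>
    R q * u i q * ((∑ j, dirDeriv (b j) (dirDeriv (b j) L) q)
      + (∑ j, dirDeriv (b j) L q * dirDeriv (b j) L q / 2)
      - (∑ j, u j q * u j q / 2) - P q) + dirDeriv (b i) L q * dirDeriv (1, 0) R q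
  have he : ContDiff ℝ (⊤ : ℕ∞) e := by simp only [e]; fun_prop
  have hG : ∀ i, ContDiff ℝ (⊤ : ℕ∞) (G i) := fun i => by simp only [G]; fun_prop
  have hbal : ∀ t ∈ Set.Icc (0 : ℝ) T, ∀ x,
      dirDeriv (1, 0) e (t, x) = ∑ i, pd i (fun y => G i (t, y)) x := by
    intro t ht x
    simp only [fun i => pd_slice (hG i) i t x]
    refine dirDeriv_energy_eq_divergence (1, 0) b hρ hL hP hW hu hRL hWP hpP (t, x) ?_ fun i => ?_
    · rw [← hmass t ht x, (hasDerivAt_slice hρ t x).deriv]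
      simp only [hRu]
      simp only [← pd_slice (hJi _), b]
    · have hm := hmom t ht x i
      have hJJ : ∀ j, ContDiff ℝ (⊤ : ℕ∞)
          (fun q : ℝ × (Fin n → ℝ) => R q * u j q * u i q) := fun j => (hρ.mul (hu j)).mul (hu i)
      have hQ : ∀ j, ContDiff ℝ (⊤ : ℕ∞)
          (fun q => R q * dirDeriv (b i) (dirDeriv (b j) L) q) := fun j => by fun_prop
      have e1 : ∀ j, pd j (fun y => J t y i * J t y j / ρ t y) x
          = dirDeriv (b j) (fun q => R q * u j q * u i q) (t, x) := fun j => by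
        rw [← pd_slice (hJJ j)]
        congr 1
        funext y
        have := hR0 (t, y)
        simp only [u, R] at this ⊢
        field_simp
      have e2 : ∀ j, pd j (fun y => ρ t y * pd i (pd j (fun z => Real.log (ρ t z))) y) x
          = dirDeriv (b j) (fun q => R q * dirDeriv (b i) (dirDeriv (b j) L) q) (t, x) :=
        fun j => by
        rw [← pd_slice (hQ j)]
        congr 1
        funext y
        congr 1
        rw [← pd_slice (contDiff_dirDeriv hL (b j))]
        congr 1
        funext z
        exact pd_slice hL j t z
      rw [hRu, ← (hasDerivAt_slice (hJi i) t x).deriv, ← pd_slice hp,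
        ← Finset.sum_congr rfl fun j _ => e1 j, ← Finset.sum_congr rfl fun j _ => e2 j]
      exact hm
  have hper : ∀ t i, ZPeriodic (fun y => G i (t, y)) := by
    intro t i x k
    let κ : ℝ × (Fin n → ℝ) := (0, fun i => (k i : ℝ))
    have hκ : ∀ q : ℝ × (Fin n → ℝ), q + κ = (q.1, q.2 + fun i => (k i : ℝ)) := fun q => by
      ext <;> simp [κ]
    have hRk : ∀ q, R (q + κ) = R q := fun q => by rw [hκ]; exact hρper q.1 q.2 k
    have hLk : ∀ q, L (q + κ) = L q := fun q => by simp only [L, hRk]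
    have huk : ∀ j q, u j (q + κ) = u j q := fun j q => by
      simp only [u, hRk]
      rw [hκ]
      simp only [hJper q.1 q.2 k]
    have hdL : ∀ v q, dirDeriv v L (q + κ) = dirDeriv v L q := fun v q =>
      dirDeriv_add_period hLk v q
    have h := hκ (t, x)
    simp only at h ⊢
    rw [← h]
    simp only [G, P, hRk, huk, hdL, dirDeriv_add_period hRk,
      fun v w q => dirDeriv_add_period (hdL w) v q]
  have hint : ∀ t ∈ Set.Icc (0 : ℝ) T,
      ∫ x in Set.Icc (0 : Fin n → ℝ) 1, dirDeriv (1, 0) e (t, x) = 0 := fun t ht => by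
    rw [funext fun x => hbal t ht x]
    exact integral_sum_pd_eq_zero (fun i => (hG i).comp (contDiff_prodMk_right t)) (hper t)
  have hderiv : ∀ t, HasDerivAt (fun s => ∫ x in Set.Icc (0 : Fin n → ℝ) 1, e (s, x))
      (∫ x in Set.Icc (0 : Fin n → ℝ) 1, dirDeriv (1, 0) e (t, x)) t := fun t =>
    hasDerivAt_integral_of_contDiff_compact he isCompact_Icc t
  have henergy : ∀ t x, ((∑ i, J t x i ^ 2) + ∑ i, pd i (ρ t) x ^ 2) / (2 * ρ t x)
      + (ρ t x ^ γ - 1 - γ * (ρ t x - 1)) / (γ * (γ - 1)) = e (t, x) := by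
    intro t x
    have hr : ρ t x ≠ 0 := hR0 (t, x)
    have h1 : ∀ i, pd i (ρ t) x = ρ t x * dirDeriv (b i) L (t, x) := fun i =>
      (pd_slice hρ i t x).trans (congrFun (hRL (b i)) (t, x))
    simp only [h1, e, W, u, R, add_div, Finset.sum_div, Finset.mul_sum]
    congr 2 <;> refine Finset.sum_congr rfl fun i _ => ?_ <;> field_simp
  simp only [henergy]
  exact constant_of_has_deriv_right_zero (fun t _ => (hderiv t).continuousAt.continuousWithinAt)
    fun t ht => by
      have h := (hderiv t).hasDerivWithinAt (s := Set.Ici t)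
      rwa [hint t (Set.Ico_subset_Icc_self ht)] at h
end
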